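/- arXiv:1704.01684 — 3 statements merged into one kernel-verified Lean document; each statement's English description precedes it below -/
import Mathlib

section
/- The R-module M is not projective. -/
noncomputable section

open MvPolynomial

/-- `A = ℂ[x,y]`, the polynomial ring in two variables (the ring `ℂ[E₄,E₆]`). -/
abbrev Apoly : Type := MvPolynomial (Fin 2) ℂ

/-- `ℂ[x,y,z]`, the polynomial ring in three variables. -/
abbrev Ppoly : Type := MvPolynomial (Fin 3) ℂ

/-- The ideal `(x³ − y² − 1728·z²)` of `ℂ[x,y,z]`. -/
def modRelIdeal : Ideal Ppoly := Ideal.span {X 0 ^ 3 - X 1 ^ 2 - 1728 * X 2 ^ 2}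

/-- `R = ℂ[x,y,z]/(x³ − y² − 1728·z²)`, the ring of scalar modular forms for `Γ²`. -/
abbrev Rring : Type := Ppoly ⧸ modRelIdeal

/-- The `A`-linear action of `z` on `M = A ⊕ A`:
`z·(f,g) = (u·y·f − (u/6)·x²·g, 6·u·x·f − u·y·g)`. -/
def zAct (u : ℂ) : (Apoly × Apoly) →ₗ[Apoly] (Apoly × Apoly) where
  toFun f := (C u * X 1 * f.1 - C (u / 6) * X 0 ^ 2 * f.2,
              C (6 * u) * X 0 * f.1 - C u * X 1 * f.2)
  map_add' f g := by
    refine Prod.ext ?_ ?_ <;> simp <;> ring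
  map_smul' a f := by
    refine Prod.ext ?_ ?_ <;> simp [smul_eq_mul] <;> ring

/-- Viewing `ℂ[x,y,z]` as `A[z]`: the algebra map sending `x, y` to the constants `x, y`
and `z` to the polynomial variable. -/
def toPolyA : Ppoly →ₐ[ℂ] Polynomial Apoly :=
  MvPolynomial.aeval ![Polynomial.C (X 0), Polynomial.C (X 1), Polynomial.X]

/-- The action of `ℂ[x,y,z]` on `M = A ⊕ A`, in which `x` and `y` act coordinatewise
(by multiplication) and `z` acts by `zAct u`. -/
def actHom (u : ℂ) : Ppoly →+* Module.End Apoly (Apoly × Apoly) :=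
  ((Polynomial.aeval (zAct u)).toRingHom).comp (toPolyA).toRingHom

set_option maxHeartbeats 1000000 in
set_option synthInstance.maxHeartbeats 400000 in
/-- The action is well defined on `R`, since the square of the `z`-action is multiplication
by `(x³ − y²)/1728`. -/
theorem actHom_rel (u : ℂ) (hu : u ^ 2 = -1 / 1728) :
    ∀ a ∈ modRelIdeal, actHom u a = 0 := by
  intro a ha
  rw [modRelIdeal, Ideal.mem_span_singleton] at ha
  obtain ⟨c, rfl⟩ := ha
  rw [map_mul]
  suffices h : actHom u (X 0 ^ 3 - X 1 ^ 2 - 1728 * X 2 ^ 2) = 0 by rw [h, zero_mul]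
  have h1 : (C u : Apoly) * C u = C (-1 / 1728) := by
    rw [← map_mul]; congr 1; rw [← sq, hu]
  have h2 : (C (u / 6) : Apoly) * C (6 * u) = C (-1 / 1728) := by
    rw [← map_mul]; congr 1; rw [← hu]; ring
  have h3 : ((1728 : ℕ) : Apoly) * C (-1 / 1728) = -1 := by
    have h : ((1728 : ℕ) : Apoly) = C (1728 : ℂ) := by push_cast; simp [map_ofNat]
    rw [h, ← map_mul]; norm_num
  refine LinearMap.ext fun f => ?_
  simp only [actHom, toPolyA, RingHom.coe_comp, Function.comp_apply, AlgHom.toRingHom_eq_coe,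
    RingHom.coe_coe, map_sub, map_mul, map_pow, map_ofNat, aeval_X,
    Matrix.cons_val_zero, Matrix.cons_val_one, Matrix.head_cons,
    Matrix.cons_val_two, Matrix.tail_cons,
    Polynomial.aeval_C, Polynomial.aeval_X]
  rw [← map_pow, ← map_pow]
  simp only [LinearMap.sub_apply, LinearMap.zero_apply, Module.algebraMap_end_apply,
    Module.End.mul_apply, pow_two, Module.End.mul_apply, smul_eq_mul,
    Module.End.ofNat_apply]
  refine Prod.ext ?_ ?_ <;>
    simp only [zAct, LinearMap.coe_mk, AddHom.coe_mk, Prod.smul_fst, Prod.smul_snd,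
      Prod.fst_sub, Prod.snd_sub, Prod.fst_zero, Prod.snd_zero, smul_eq_mul,
      Prod.smul_mk, Prod.mk_sub_mk]
  · linear_combination (-(1728 : Apoly) * X 1 ^ 2 * f.1) * h1 +
      ((1728 : Apoly) * X 0 ^ 3 * f.1) * h2 + (((X 0 : Apoly) ^ 3 - X 1 ^ 2) * f.1) * h3
  · linear_combination (-(1728 : Apoly) * X 1 ^ 2 * f.2) * h1 +
      ((1728 : Apoly) * X 0 ^ 3 * f.2) * h2 + (((X 0 : Apoly) ^ 3 - X 1 ^ 2) * f.2) * h3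

/-- The ring homomorphism `R →+* End_A(A ⊕ A)` describing the module `M = M(β)`. -/
def actHomBar (u : ℂ) (hu : u ^ 2 = -1 / 1728) :
    Rring →+* Module.End Apoly (Apoly × Apoly) :=
  Ideal.Quotient.lift modRelIdeal (actHom u) (actHom_rel u hu)

/-- The `R`-module structure on `M = A ⊕ A`, in which `x` and `y` act coordinatewise and
`z` acts by `z·(f,g) = (u·y·f − (u/6)·x²·g, 6·u·x·f − u·y·g)`. -/
def modM (u : ℂ) (hu : u ^ 2 = -1 / 1728) : Module Rring (Apoly × Apoly) :=
  Module.compHom _ (actHomBar u hu)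


/-- The tangent-direction homomorphism `x, y ↦ 0`, `z ↦ ε`. -/
def dualP : Ppoly →ₐ[ℂ] DualNumber ℂ := MvPolynomial.aeval ![0, 0, DualNumber.eps]

theorem dualP_rel : ∀ a ∈ modRelIdeal, (dualP : Ppoly →+* DualNumber ℂ) a = 0 := by
  intro a ha
  rw [modRelIdeal, Ideal.mem_span_singleton] at ha
  obtain ⟨c, rfl⟩ := ha
  simp [dualP, pow_two, DualNumber.eps_mul_eps]

def dualR : Rring →+* DualNumber ℂ := Ideal.Quotient.lift modRelIdeal _ dualP_rel

/-- constant term of the first coordinate -/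
def evF (m : Apoly × Apoly) : ℂ := constantCoeff m.1

theorem evF_act (u : ℂ) (P : Ppoly) : ∀ m : Apoly × Apoly,
    evF (actHom u P m) = (dualP P).fst * evF m := by
  induction P using MvPolynomial.induction_on with
  | C a =>
    intro m
    have : actHom u (C a) = algebraMap Apoly _ (C a) := by
      simp only [actHom, toPolyA, RingHom.coe_comp, Function.comp_apply,
        AlgHom.toRingHom_eq_coe, RingHom.coe_coe, MvPolynomial.aeval_C]
      rw [IsScalarTower.algebraMap_apply ℂ Apoly (Polynomial Apoly), AlgHom.commutes]
      rfl
    rw [this]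
    simp [evF, dualP, Module.algebraMap_end_apply, TrivSqZeroExt.algebraMap_eq_inl]
  | add p q hp hq =>
    intro m
    have : evF (actHom u (p + q) m) = evF (actHom u p m) + evF (actHom u q m) := by
      simp [evF]
    rw [this, hp, hq, map_add, TrivSqZeroExt.fst_add, add_mul]
  | mul_X p i hp =>
    intro m
    rw [map_mul, Module.End.mul_apply, hp, map_mul, TrivSqZeroExt.fst_mul, mul_assoc]
    congr 1
    fin_cases i <;> simp [actHom, toPolyA, dualP, evF, zAct, Module.algebraMap_end_apply]

/-- The `R`-module `M` is not projective. -/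
theorem M_not_projective (u : ℂ) (hu : u ^ 2 = -1 / 1728) :
    letI := modM u hu
    ¬ Module.Projective Rring (Apoly × Apoly) := by
  letI inst : Module Rring (Apoly × Apoly) := modM u hu
  intro hproj
  obtain ⟨s, hs⟩ := hproj.out
  have hsm : ∀ (P : Ppoly) (m : Apoly × Apoly),
      (Ideal.Quotient.mk modRelIdeal P : Rring) • m = actHom u P m := fun _ _ => rfl
  have hev : ∀ (r : Rring) (m : Apoly × Apoly), evF (r • m) = (dualR r).fst * evF m := by
    intro r m
    obtain ⟨P, rfl⟩ := Ideal.Quotient.mk_surjective r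
    rw [hsm, evF_act]
    rfl
  have hrel : (Ideal.Quotient.mk modRelIdeal (X 2 - C u * X 1) : Rring) • ((1, 0) : Apoly × Apoly)
      = (Ideal.Quotient.mk modRelIdeal (C (6 * u) * X 0) : Rring) • ((0, 1) : Apoly × Apoly) := by
    have hC : ∀ a : ℂ, actHom u (C a) = algebraMap Apoly _ (C a) := by
      intro a
      simp only [actHom, toPolyA, RingHom.coe_comp, Function.comp_apply,
        AlgHom.toRingHom_eq_coe, RingHom.coe_coe, MvPolynomial.aeval_C]
      rw [IsScalarTower.algebraMap_apply ℂ Apoly (Polynomial Apoly), AlgHom.commutes]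
      rfl
    have h0 : actHom u (X 0) = algebraMap Apoly _ (X 0) := by simp [actHom, toPolyA]
    have h1 : actHom u (X 1) = algebraMap Apoly _ (X 1) := by simp [actHom, toPolyA]
    have h2 : actHom u (X 2) = zAct u := by simp [actHom, toPolyA]
    rw [hsm, hsm, map_sub, map_mul, map_mul, hC, hC, h0, h1, h2]
    refine Prod.ext ?_ ?_ <;> simp [zAct, Module.algebraMap_end_apply, mul_assoc]
  have hz : ∀ i, (dualR (s (1, 0) i)).fst = 0 := by
    intro i
    have h := congrArg (fun m => dualR (s m i)) hrel
    simp only [map_smul, Finsupp.smul_apply, smul_eq_mul, map_mul] at h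
    have e1 : dualR (Ideal.Quotient.mk modRelIdeal (X 2 - C u * X 1)) = DualNumber.eps := by
      change dualP _ = _
      simp [dualP]
    have e2 : dualR (Ideal.Quotient.mk modRelIdeal (X 0)) = 0 := by
      change dualP _ = _
      simp [dualP]
    rw [e1, e2, mul_zero, zero_mul] at h
    simpa using congrArg TrivSqZeroExt.snd h
  have hF := hs (1, 0)
  rw [Finsupp.linearCombination_apply, Finsupp.sum] at hF
  have hadd : ∀ (t : Finset (Apoly × Apoly)) (f : Apoly × Apoly → Apoly × Apoly),
      evF (∑ i ∈ t, f i) = ∑ i ∈ t, evF (f i) := by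
    intro t f
    simp [evF, Prod.fst_sum]
  have h1 := congrArg evF hF
  rw [hadd] at h1
  rw [Finset.sum_eq_zero (fun i _ => by rw [hev, hz, zero_mul])] at h1
  simp [evF] at h1
end
end

section
/- The R-module M is not free. -/
noncomputable section

open MvPolynomial

/-- Abstract criterion: if every element is, up to a regular scalar `d`, a multiple of `e`,
and the module needs two generators, it is not free. -/
theorem not_free_aux {R M : Type*} [CommRing R] [AddCommGroup M] [Module R M]
    (e : M) (d : R) (hd : ∀ m : M, d • m = 0 → m = 0)
    (he : ∀ m : M, ∃ r : R, d • m = r • e)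
    (hM : ∀ m : M, ∃ n : M, ∀ r : R, r • m ≠ n) : ¬ Module.Free R M := by
  intro hfree
  obtain ⟨n0, hn0⟩ := hM 0
  have hn0' : n0 ≠ 0 := fun h => hn0 0 (by simp [h])
  haveI : Nontrivial R := by
    by_contra h
    rw [not_nontrivial_iff_subsingleton] at h
    exact hn0' (by rw [← one_smul R n0, Subsingleton.elim (1 : R) 0, zero_smul])
  let b := Module.Free.chooseBasis R M
  have hsub : ∀ i j : Module.Free.ChooseBasisIndex R M, i = j := by
    intro i j
    by_contra hij
    obtain ⟨r, hr⟩ := he (b i)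
    obtain ⟨s, hs⟩ := he (b j)
    have hrel : (d * s) • b i = (d * r) • b j := by
      rw [mul_comm d s, mul_comm d r, mul_smul, mul_smul, hr, hs, smul_smul, smul_smul, mul_comm]
    have h2 := congrArg (fun m => b.repr m i) hrel
    have hji : ¬ j = i := fun h => hij h.symm
    simp [Finsupp.single_apply, hji] at h2
    have h3 : d • d • b j = 0 := by
      rw [hs, smul_smul, h2, zero_smul]
    exact b.ne_zero j (hd _ (hd _ h3))
  have hspan : ∀ i (n : M), ∃ r : R, r • b i = n := by
    intro i n
    have h1 : n ∈ Submodule.span R (Set.range b) := by rw [b.span_eq]; trivial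
    have h2 : Set.range b = {b i} := by
      ext m
      constructor
      · rintro ⟨j, rfl⟩
        rw [hsub j i]; rfl
      · rintro rfl
        exact ⟨i, rfl⟩
    rw [h2] at h1
    exact Submodule.mem_span_singleton.mp h1
  have hne : Nonempty (Module.Free.ChooseBasisIndex R M) := by
    by_contra h
    rw [not_nonempty_iff] at h
    exact hn0' (b.repr.injective (Subsingleton.elim _ _))
  obtain ⟨i⟩ := hne
  obtain ⟨n, hn⟩ := hM (b i)
  obtain ⟨r, hr⟩ := hspan i n
  exact hn r hr

theorem actHom_X0 (u : ℂ) (m : Apoly × Apoly) : actHom u (X 0) m = (X 0 : Apoly) • m := by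
  simp [actHom, toPolyA]

theorem actHom_X1 (u : ℂ) (m : Apoly × Apoly) : actHom u (X 1) m = (X 1 : Apoly) • m := by
  simp [actHom, toPolyA]

theorem actHom_X2 (u : ℂ) (m : Apoly × Apoly) : actHom u (X 2) m = zAct u m := by
  simp [actHom, toPolyA]

theorem actHom_C (u c : ℂ) (m : Apoly × Apoly) : actHom u (C c) m = (C c : Apoly) • m := by
  have h : toPolyA (C c) = Polynomial.C (C c) := by
    rw [toPolyA, MvPolynomial.aeval_C]; rfl
  simp only [actHom, RingHom.coe_comp, Function.comp_apply, AlgHom.toRingHom_eq_coe,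
    RingHom.coe_coe, h, Polynomial.aeval_C, Module.algebraMap_end_apply]

theorem actHom_lift (u : ℂ) (a : Apoly) : ∃ p : Ppoly, ∀ m, actHom u p m = a • m := by
  induction a using MvPolynomial.induction_on with
  | C c => exact ⟨C c, actHom_C u c⟩
  | add p q hp hq =>
    obtain ⟨p', hp⟩ := hp
    obtain ⟨q', hq⟩ := hq
    exact ⟨p' + q', fun m => by rw [map_add, LinearMap.add_apply, hp, hq, add_smul]⟩
  | mul_X p i hp =>
    obtain ⟨p', hp⟩ := hp
    fin_cases i
    · exact ⟨p' * X 0, fun m => by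
        rw [map_mul, Module.End.mul_apply, actHom_X0, hp, smul_smul]; rfl⟩
    · exact ⟨p' * X 1, fun m => by
        rw [map_mul, Module.End.mul_apply, actHom_X1, hp, smul_smul]; rfl⟩

theorem actHom_eps (u : ℂ) (p : Ppoly) : ∃ c : ℂ, ∀ m : Apoly × Apoly,
    constantCoeff (actHom u p m).1 = c * constantCoeff m.1 ∧
    constantCoeff (actHom u p m).2 = c * constantCoeff m.2 := by
  induction p using MvPolynomial.induction_on with
  | C c => exact ⟨c, fun m => by rw [actHom_C]; simp⟩
  | add p q hp hq =>
    obtain ⟨c, hp⟩ := hp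
    obtain ⟨d, hq⟩ := hq
    refine ⟨c + d, fun m => ?_⟩
    simp only [map_add, LinearMap.add_apply, Prod.fst_add, Prod.snd_add, (hp m).1, (hp m).2,
      (hq m).1, (hq m).2, add_mul, and_self]
  | mul_X p i hp =>
    obtain ⟨c, hp⟩ := hp
    refine ⟨0, fun m => ?_⟩
    rw [map_mul, Module.End.mul_apply, (hp _).1, (hp _).2]
    fin_cases i
    · have := actHom_X0 u m
      simp [this]
    · have := actHom_X1 u m
      simp [this]
    · have := actHom_X2 u m
      simp [this, zAct]

/-- The `R`-module `M` is not free. -/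
theorem M_not_free (u : ℂ) (hu : u ^ 2 = -1 / 1728) :
    letI := modM u hu
    ¬ Module.Free Rring (Apoly × Apoly) := by
  letI := modM u hu
  have hsm : ∀ (p : Ppoly) (m : Apoly × Apoly),
      (Ideal.Quotient.mk modRelIdeal p : Rring) • m = actHom u p m := fun p m => rfl
  have hu0 : u ≠ 0 := by
    rintro rfl
    norm_num at hu
  obtain ⟨d, hd⟩ := actHom_lift u (C (6 * u) * X 0)
  obtain ⟨w, hw⟩ := actHom_lift u (C u * X 1)
  refine not_free_aux ((1, 0) : Apoly × Apoly) (Ideal.Quotient.mk modRelIdeal d) ?_ ?_ ?_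
  · intro m hm
    rw [hsm, hd] at hm
    refine (smul_eq_zero.mp hm).resolve_left ?_
    exact mul_ne_zero (by simpa using hu0) (X_ne_zero 0)
  · rintro ⟨f, g⟩
    obtain ⟨f', hf⟩ := actHom_lift u f
    obtain ⟨g', hg⟩ := actHom_lift u g
    refine ⟨Ideal.Quotient.mk modRelIdeal (d * f' + g' * (X 2 - w)), ?_⟩
    rw [hsm, hsm, hd]
    simp only [map_add, map_mul, map_sub, LinearMap.add_apply, LinearMap.sub_apply,
      Module.End.mul_apply, hd, hf, hg, hw, actHom_X2]
    refine Prod.ext ?_ ?_ <;> simp [zAct] <;> ring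
  · rintro m
    by_contra hcon
    push Not at hcon
    obtain ⟨r, hr⟩ := hcon (1, 0)
    obtain ⟨s, hs⟩ := hcon (0, 1)
    obtain ⟨p, rfl⟩ := Ideal.Quotient.mk_surjective r
    obtain ⟨q, rfl⟩ := Ideal.Quotient.mk_surjective s
    rw [hsm] at hr hs
    obtain ⟨c, hc⟩ := actHom_eps u p
    obtain ⟨c', hc'⟩ := actHom_eps u q
    have h1 := hc m
    have h2 := hc' m
    rw [hr] at h1
    rw [hs] at h2
    simp only [map_one, map_zero] at h1 h2
    have : (1 : ℂ) = 0 := by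
      linear_combination (c' * constantCoeff m.2) * h1.1 + h2.2 - (c' * constantCoeff m.1) * h1.2
    exact one_ne_zero this
end
end

section
/- Let p: R² → M be the R-module homomorphism defined by p(r,s) = r·(1,0) + s·(0,1). Then the kernel of p, regarded as a module over the subring A = ℂ[x,y] of R, is free of rank 2 with basis e₁ = (−u·y + z, −6u·x) and e₂ = (u·x², 6u·y + 6z); that is, ker p = A·e₁ ⊕ A·e₂. -/
noncomputable section

open MvPolynomial

/-- The inclusion `A = ℂ[x,y] → R = ℂ[x,y,z]/(x³ − y² − 1728·z²)`. -/
def algA : Apoly →+* Rring :=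
  (Ideal.Quotient.mk modRelIdeal).comp
    ((MvPolynomial.rename (Fin.castSucc : Fin 2 → Fin 3)).toRingHom)

/-- The element `e₁ = (−u·y + z, −6u·x)` of `R²`. -/
def eVec1 (u : ℂ) : Rring × Rring :=
  (Ideal.Quotient.mk modRelIdeal (-(C u * X 1) + X 2),
   Ideal.Quotient.mk modRelIdeal (-(C (6 * u) * X 0)))

/-- The element `e₂ = (u·x², 6u·y + 6z)` of `R²`. -/
def eVec2 (u : ℂ) : Rring × Rring :=
  (Ideal.Quotient.mk modRelIdeal (C u * X 0 ^ 2),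
   Ideal.Quotient.mk modRelIdeal (C (6 * u) * X 1 + 6 * X 2))


theorem kp_act_algA (u : ℂ) (hu : u ^ 2 = -1 / 1728) (a : Apoly) (m : Apoly × Apoly) :
    actHomBar u hu (algA a) m = a • m := by
  have h : actHomBar u hu (algA a) = algebraMap Apoly (Module.End Apoly (Apoly × Apoly)) a := by
    change actHom u (rename Fin.castSucc a) = _
    have h2 : toPolyA (rename Fin.castSucc a) = Polynomial.C a := by
      have h3 : toPolyA.comp (rename (Fin.castSucc : Fin 2 → Fin 3)) =
          (Polynomial.CAlgHom : Apoly →ₐ[ℂ] Polynomial Apoly) := by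
        refine MvPolynomial.algHom_ext fun i => ?_
        fin_cases i <;> simp [toPolyA]
      exact DFunLike.congr_fun h3 a
    change Polynomial.aeval (zAct u) (toPolyA (rename Fin.castSucc a)) = _
    rw [h2, Polynomial.aeval_C]
  rw [h, Module.algebraMap_end_apply]

theorem kp_act_z (u : ℂ) (hu : u ^ 2 = -1 / 1728) (m : Apoly × Apoly) :
    actHomBar u hu (Ideal.Quotient.mk modRelIdeal (X 2)) m = zAct u m := by
  have h : actHomBar u hu (Ideal.Quotient.mk modRelIdeal (X 2)) = zAct u := by
    change Polynomial.aeval (zAct u) (toPolyA (X 2)) = _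
    simp [toPolyA]
  rw [h]

theorem kp_mk_C (c : ℂ) : Ideal.Quotient.mk modRelIdeal (C c) = algA (C c) := by
  simp [algA]

theorem kp_mk_X0 : Ideal.Quotient.mk modRelIdeal (X 0) = algA (X 0) := by
  simp [algA]

theorem kp_mk_X1 : Ideal.Quotient.mk modRelIdeal (X 1) = algA (X 1) := by
  simp [algA]

theorem kp_zsq : Ideal.Quotient.mk modRelIdeal (X 2) * Ideal.Quotient.mk modRelIdeal (X 2) =
    algA (C (1 / 1728) * (X 0 ^ 3 - X 1 ^ 2)) := by
  rw [map_mul, map_sub, map_pow, map_pow, ← kp_mk_C, ← kp_mk_X0, ← kp_mk_X1]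
  simp only [← map_mul, ← map_sub, ← map_pow]
  rw [Ideal.Quotient.eq, modRelIdeal, Ideal.mem_span_singleton]
  refine ⟨-C (1 / 1728), ?_⟩
  have h : (C (1 / 1728) : Ppoly) * 1728 = 1 := by
    have h : (1728 : Ppoly) = C (1728 : ℂ) := by simp [map_ofNat]
    rw [h, ← map_mul]; norm_num
  linear_combination (-(X 2 : Ppoly) ^ 2) * h

theorem kp_span (r : Rring) :
    ∃ a b : Apoly, r = algA a + algA b * Ideal.Quotient.mk modRelIdeal (X 2) := by
  obtain ⟨f, rfl⟩ := Ideal.Quotient.mk_surjective r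
  induction f using MvPolynomial.induction_on with
  | C c => exact ⟨C c, 0, by rw [kp_mk_C, map_zero, zero_mul, add_zero]⟩
  | add f g hf hg =>
    obtain ⟨a, b, h⟩ := hf
    obtain ⟨a', b', h'⟩ := hg
    refine ⟨a + a', b + b', ?_⟩
    rw [map_add, h, h', map_add, map_add]; ring
  | mul_X f i hf =>
    obtain ⟨a, b, h⟩ := hf
    rw [map_mul, h]
    have key : i = 0 ∨ i = 1 ∨ i = 2 := by fin_cases i <;> simp
    rcases key with rfl | rfl | rfl
    · refine ⟨a * X 0, b * X 0, ?_⟩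
      rw [kp_mk_X0, map_mul, map_mul]; ring
    · refine ⟨a * X 1, b * X 1, ?_⟩
      rw [kp_mk_X1, map_mul, map_mul]; ring
    · refine ⟨b * (C (1 / 1728) * (X 0 ^ 3 - X 1 ^ 2)), a, ?_⟩
      rw [map_mul algA b, ← kp_zsq]; ring

theorem kp_e1 (u : ℂ) : eVec1 u = (algA (-(C u * X 1)) + Ideal.Quotient.mk modRelIdeal (X 2),
    algA (-(C (6 * u) * X 0))) := by
  simp only [eVec1, map_add, map_neg, map_mul algA, map_mul (Ideal.Quotient.mk modRelIdeal),
    kp_mk_C, kp_mk_X0, kp_mk_X1]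

theorem kp_e2 (u : ℂ) : eVec2 u = (algA (C u * X 0 ^ 2),
    algA (C (6 * u) * X 1) + 6 * Ideal.Quotient.mk modRelIdeal (X 2)) := by
  simp only [eVec2, map_add, map_pow, map_mul algA, map_mul (Ideal.Quotient.mk modRelIdeal),
    kp_mk_C, kp_mk_X0, kp_mk_X1, map_ofNat]

theorem kp_comb (u : ℂ) (a b : Apoly) : algA a • eVec1 u + algA b • eVec2 u =
    (algA (-(C u * X 1 * a) + C u * X 0 ^ 2 * b) + algA a * Ideal.Quotient.mk modRelIdeal (X 2),
     algA (-(C (6 * u) * X 0 * a) + C (6 * u) * X 1 * b) +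
      algA (6 * b) * Ideal.Quotient.mk modRelIdeal (X 2)) := by
  rw [kp_e1, kp_e2]
  refine Prod.ext ?_ ?_ <;>
    simp only [Prod.fst_add, Prod.snd_add, Prod.smul_fst, Prod.smul_snd, smul_eq_mul, map_add,
      map_neg, map_mul, map_pow, map_ofNat] <;> ring

theorem kp_act (u : ℂ) (hu : u ^ 2 = -1 / 1728) (a b : Apoly) (m : Apoly × Apoly) :
    actHomBar u hu (algA a + algA b * Ideal.Quotient.mk modRelIdeal (X 2)) m =
      a • m + b • zAct u m := by
  rw [map_add, map_mul, LinearMap.add_apply, Module.End.mul_apply, kp_act_algA, kp_act_z,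
    kp_act_algA]

/-- If `p : R² → M` is the `R`-module homomorphism `p(r,s) = r·(1,0) + s·(0,1)`, then
`ker p`, as a module over the subring `A = ℂ[x,y]` of `R`, is free of rank `2` with basis
`e₁ = (−u·y + z, −6u·x)` and `e₂ = (u·x², 6u·y + 6z)`; that is, `ker p = A·e₁ ⊕ A·e₂`. -/
theorem ker_p_free_over_A (u : ℂ) (hu : u ^ 2 = -1 / 1728) :
    letI := modM u hu
    ∀ p : (Rring × Rring) →ₗ[Rring] (Apoly × Apoly),
      (∀ r s : Rring, p (r, s) = r • ((1 : Apoly), (0 : Apoly)) + s • ((0 : Apoly), (1 : Apoly))) →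
        ((∀ v : Rring × Rring,
            p v = 0 ↔ ∃ a b : Apoly, v = algA a • eVec1 u + algA b • eVec2 u) ∧
          (∀ a b : Apoly, algA a • eVec1 u + algA b • eVec2 u = 0 → a = 0 ∧ b = 0)) := by
  intro p hp
  have hu0 : u ≠ 0 := by
    rintro rfl
    norm_num at hu
  have hCu : (C u : Apoly) ≠ 0 := by simpa using hu0
  have hC6u : (C (6 * u) : Apoly) ≠ 0 := by simpa using hu0
  have h6 : (C (u / 6) : Apoly) * 6 = C u := by
    have h : (6 : Apoly) = C (6 : ℂ) := by simp [map_ofNat]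
    rw [h, ← map_mul]; congr 1; ring
  have h66 : (6 : Apoly) * C (1 / 6) = 1 := by
    have h : (6 : Apoly) = C (6 : ℂ) := by simp [map_ofNat]
    rw [h, ← map_mul]; norm_num
  have hp' : ∀ a b c d : Apoly,
      p (algA a + algA b * Ideal.Quotient.mk modRelIdeal (X 2),
        algA c + algA d * Ideal.Quotient.mk modRelIdeal (X 2)) =
      (a + b * (C u * X 1) - d * (C (u / 6) * X 0 ^ 2),
        b * (C (6 * u) * X 0) + c - d * (C u * X 1)) := by
    intro a b c d
    rw [hp]
    change actHomBar u hu _ _ + actHomBar u hu _ _ = _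
    rw [kp_act, kp_act]
    refine Prod.ext ?_ ?_ <;> simp [zAct] <;> ring
  refine ⟨?_, ?_⟩
  · rintro ⟨r, s⟩
    obtain ⟨a, b, rfl⟩ := kp_span r
    obtain ⟨c, d, rfl⟩ := kp_span s
    constructor
    · intro h
      rw [hp', Prod.mk_eq_zero] at h
      obtain ⟨h1, h2⟩ := h
      refine ⟨b, C (1 / 6) * d, ?_⟩
      rw [kp_comb]
      have e1 : a = -(C u * X 1 * b) + C u * X 0 ^ 2 * (C (1 / 6) * d) := by
        linear_combination h1 + C (1 / 6) * d * X 0 ^ 2 * h6 - d * C (u / 6) * X 0 ^ 2 * h66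
      have h7 : (C (6 * u) : Apoly) = 6 * C u := by rw [map_mul, map_ofNat]
      have e2 : c = -(C (6 * u) * X 0 * b) + C (6 * u) * X 1 * (C (1 / 6) * d) := by
        linear_combination h2 - X 1 * C (1 / 6) * d * h7 - d * C u * X 1 * h66
      have e3 : 6 * (C (1 / 6) * d) = d := by linear_combination d * h66
      rw [e3, ← e1, ← e2]
    · rintro ⟨a', b', h⟩
      rw [h, kp_comb, hp']
      have h7 : (C (6 * u) : Apoly) = 6 * C u := by rw [map_mul, map_ofNat]
      refine Prod.ext ?_ ?_
      · change _ = (0 : Apoly)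
        linear_combination (-b' * X 0 ^ 2) * h6
      · change _ = (0 : Apoly)
        linear_combination (b' * X 1) * h7
  · intro a b h
    rw [kp_comb, Prod.mk_eq_zero] at h
    have h1 := kp_act u hu (-(C u * X 1 * a) + C u * X 0 ^ 2 * b) a (1, 0)
    rw [h.1, map_zero, LinearMap.zero_apply] at h1
    have h2 := congrArg Prod.fst h1
    have h3 := congrArg Prod.snd h1
    simp only [zAct, LinearMap.coe_mk, AddHom.coe_mk, Prod.fst_add, Prod.snd_add, Prod.smul_fst,
      Prod.smul_snd, smul_eq_mul, Prod.fst_zero, Prod.snd_zero] at h2 h3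
    have h2' : (C u * X 0 ^ 2) * b = 0 := by linear_combination -h2
    have h3' : (C (6 * u) * X 0) * a = 0 := by linear_combination -h3
    have hX : (X 0 : Apoly) ≠ 0 := X_ne_zero 0
    exact ⟨(mul_eq_zero.mp h3').resolve_left (mul_ne_zero hC6u hX),
      (mul_eq_zero.mp h2').resolve_left (mul_ne_zero hCu (pow_ne_zero 2 hX))⟩
end
end
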